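/- Fix 0 < α < 1 with K_α := 2 sin²(απ) - πα sin(2απ) ≠ 0. For c > 0 small enough that D(c) := 2αc² sin²(απ) - π sin(2απ) sinh²(αc) ≠ 0, define B(c) = c sin²(απ)/D(c), σ(c) = 2αc²B(c), μ(c) = 2 sinh²(αc) B(c), and ζ₀(c) = -σ(c) + μ(c)/α. Then ζ₀(c)/c³ → (2α²/3) · sin²(απ)/K_α as c → 0⁺. In particular ζ₀(c) = O(c³) as c → 0⁺. -/

import Mathlib

open Complex Real Filter Asymptotics

/-- `B = c sin²(απ) / (2αc² sin²(απ) - π sin(2απ) sinh²(αc))`. -/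
noncomputable def talbotB (α c : ℝ) : ℝ :=
  c * Real.sin (α * π) ^ 2 /
    (2 * α * c ^ 2 * Real.sin (α * π) ^ 2
      - π * Real.sin (2 * α * π) * Real.sinh (α * c) ^ 2)

/-- `σ = 2αc²B`. -/
noncomputable def talbotSigma (α c : ℝ) : ℝ := 2 * α * c ^ 2 * talbotB α c

/-- `μ = 2 sinh²(αc) B`. -/
noncomputable def talbotMu (α c : ℝ) : ℝ := 2 * Real.sinh (α * c) ^ 2 * talbotB α c

/-- `ζ₀(c) = ζ(0) = -σ + μ/α`, the real-axis crossing of the contour shape. -/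
noncomputable def talbotZeta0 (α c : ℝ) : ℝ := -talbotSigma α c + talbotMu α c / α

theorem Real.tendsto_sinh_div_self :
    Tendsto (fun x : ℝ => Real.sinh x / x) (nhdsWithin 0 {0}ᶜ) (nhds 1) := by
  have h := hasDerivAt_iff_tendsto_slope_zero.mp (Real.hasDerivAt_sinh 0)
  simpa [div_eq_inv_mul] using h

theorem Real.tendsto_cosh_sub_one_div_sq :
    Tendsto (fun x : ℝ => (Real.cosh x - 1) / (3 * x ^ 2)) (nhdsWithin 0 {0}ᶜ)
      (nhds (1 / 6)) := by
  have hhalf : Tendsto (fun x : ℝ => x / 2) (nhdsWithin 0 {0}ᶜ) (nhdsWithin 0 {0}ᶜ) := by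
    refine tendsto_nhdsWithin_iff.mpr ⟨?_, ?_⟩
    · exact ((continuous_id.div_const (2 : ℝ)).tendsto' 0 0 (by simp)).mono_left
        nhdsWithin_le_nhds
    · filter_upwards [self_mem_nhdsWithin] with x hx
      simpa using hx
  have h := ((Real.tendsto_sinh_div_self.comp hhalf).pow 2).div_const 6
  rw [one_pow] at h
  refine h.congr' ?_
  filter_upwards [self_mem_nhdsWithin] with x hx
  have hx0 : x ≠ 0 := hx
  have hc : Real.cosh x = 1 + 2 * Real.sinh (x / 2) ^ 2 := by
    have h2 := Real.cosh_two_mul (x / 2)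
    have hsq := Real.cosh_sq (x / 2)
    rw [mul_div_cancel₀ x two_ne_zero] at h2
    linarith
  simp only [Function.comp_apply, hc]
  field_simp
  ring

theorem Real.tendsto_sinh_sub_self_div_cube :
    Tendsto (fun x : ℝ => (Real.sinh x - x) / x ^ 3) (nhdsWithin 0 {0}ᶜ) (nhds (1 / 6)) := by
  refine HasDerivAt.lhopital_zero_nhdsNE (f' := fun x => Real.cosh x - 1)
    (g' := fun x => 3 * x ^ 2) ?_ ?_ ?_ ?_ ?_ Real.tendsto_cosh_sub_one_div_sq
  · exact .of_forall fun x => (Real.hasDerivAt_sinh x).sub (hasDerivAt_id x)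
  · exact .of_forall fun x => by simpa using hasDerivAt_pow 3 x
  · filter_upwards [self_mem_nhdsWithin] with x hx
    have hx0 : x ≠ 0 := hx
    positivity
  · exact ((Real.continuous_sinh.sub continuous_id).tendsto' 0 0 (by simp)).mono_left
      nhdsWithin_le_nhds
  · exact ((continuous_pow 3).tendsto' (0 : ℝ) 0 (by simp)).mono_left nhdsWithin_le_nhds

theorem Real.tendsto_sinh_sq_sub_sq_div_pow_four :
    Tendsto (fun x : ℝ => (Real.sinh x ^ 2 - x ^ 2) / x ^ 4) (nhdsWithin 0 {0}ᶜ)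
      (nhds (1 / 3)) := by
  have h := Real.tendsto_sinh_sub_self_div_cube.mul (Real.tendsto_sinh_div_self.add_const 1)
  rw [show (1 / 6 : ℝ) * (1 + 1) = 1 / 3 by norm_num] at h
  refine h.congr' ?_
  filter_upwards [self_mem_nhdsWithin] with x hx
  have hx0 : x ≠ 0 := hx
  field_simp
  ring

theorem talbotZeta0_div_cube {α c : ℝ} (hα : α ≠ 0) (hc : c ≠ 0) :
    talbotZeta0 α c / c ^ 3 =
      2 * α ^ 2 * Real.sin (α * π) ^ 2
          * ((Real.sinh (α * c) ^ 2 - (α * c) ^ 2) / (α * c) ^ 4) /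
        (2 * Real.sin (α * π) ^ 2
          - π * α * Real.sin (2 * α * π) * (Real.sinh (α * c) / (α * c)) ^ 2) := by
  have hD : 2 * α * c ^ 2 * Real.sin (α * π) ^ 2
      - π * Real.sin (2 * α * π) * Real.sinh (α * c) ^ 2 =
      (α * c ^ 2) * (2 * Real.sin (α * π) ^ 2
          - π * α * Real.sin (2 * α * π) * (Real.sinh (α * c) / (α * c)) ^ 2) := by
    field_simp
  simp only [talbotZeta0, talbotSigma, talbotMu, talbotB, hD]
  generalize 2 * Real.sin (α * π) ^ 2
    - π * α * Real.sin (2 * α * π) * (Real.sinh (α * c) / (α * c)) ^ 2 = d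
  rcases eq_or_ne d 0 with rfl | hd
  · simp
  · field_simp
    ring

/-- **Cubic smallness of `ζ(0)`.** For fixed `0 < α < 1` with
`K_α = 2sin²(απ) - πα sin(2απ) ≠ 0`, one has
`ζ₀(c)/c³ → (2α²/3)·sin²(απ)/K_α` as `c → 0⁺`; in particular `ζ₀(c) = O(c³)`. -/
theorem talbot_zeta0_cubic (α : ℝ) (hα0 : 0 < α) (hα1 : α < 1)
    (hK : 2 * Real.sin (α * π) ^ 2 - π * α * Real.sin (2 * α * π) ≠ 0) :
    Tendsto (fun c : ℝ => talbotZeta0 α c / c ^ 3) (nhdsWithin 0 (Set.Ioi 0))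
      (nhds ((2 * α ^ 2 / 3) * Real.sin (α * π) ^ 2 /
        (2 * Real.sin (α * π) ^ 2 - π * α * Real.sin (2 * α * π)))) ∧
    (fun c : ℝ => talbotZeta0 α c) =O[nhdsWithin 0 (Set.Ioi 0)] (fun c : ℝ => c ^ 3) := by
  have hlim : Tendsto (fun c : ℝ => talbotZeta0 α c / c ^ 3) (nhdsWithin 0 (Set.Ioi 0))
      (nhds ((2 * α ^ 2 / 3) * Real.sin (α * π) ^ 2 /
        (2 * Real.sin (α * π) ^ 2 - π * α * Real.sin (2 * α * π)))) := by
    have hscale : Tendsto (fun c : ℝ => α * c) (nhdsWithin 0 (Set.Ioi 0))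
        (nhdsWithin 0 {0}ᶜ) := by
      refine tendsto_nhdsWithin_iff.mpr ⟨?_, ?_⟩
      · exact ((continuous_const_mul α).tendsto' 0 0 (mul_zero α)).mono_left
          nhdsWithin_le_nhds
      · filter_upwards [self_mem_nhdsWithin] with c hc
        exact (mul_pos hα0 hc).ne'
    have hnum := (Real.tendsto_sinh_sq_sub_sq_div_pow_four.comp hscale).const_mul
      (2 * α ^ 2 * Real.sin (α * π) ^ 2)
    have hden := (((Real.tendsto_sinh_div_self.comp hscale).pow 2).const_mul
      (π * α * Real.sin (2 * α * π))).const_sub (2 * Real.sin (α * π) ^ 2)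
    rw [one_pow, mul_one] at hden
    have h := hnum.div hden hK
    rw [show 2 * α ^ 2 * Real.sin (α * π) ^ 2 * (1 / 3) =
      (2 * α ^ 2 / 3) * Real.sin (α * π) ^ 2 by ring] at h
    refine h.congr' ?_
    filter_upwards [self_mem_nhdsWithin] with c hc
    exact (talbotZeta0_div_cube hα0.ne' (ne_of_gt hc)).symm
  refine ⟨hlim, isBigO_of_div_tendsto_nhds ?_ _ hlim⟩
  filter_upwards [self_mem_nhdsWithin] with c hc h0
  exact absurd h0 (pow_pos hc 3).ne'
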